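/- Let d ≥ 1, let σ > 0, and let f : ℝ^d → ℝ be a bounded measurable function. Let γ denote the standard Gaussian measure N(0, I_d) on ℝ^d, and define the Gaussian-smoothed function g : ℝ^d → ℝ by g(c) = ∫ f(c + σ·w) dγ(w). Then g is differentiable at every c ∈ ℝ^d, and its gradient satisfies Stein's (Gaussian smoothing) identity: ∇g(c) = (1/σ) · ∫ f(c + σ·w) · w dγ(w), where the integral on the right is the Bochner integral of the ℝ^d-valued function w ↦ f(c + σ·w)·w against γ. -/

import Mathlib

open MeasureTheory Real

/-- The standard Gaussian measure `N(0, I_d)` on `ℝ^d`, given by its density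
`(2π)^{-d/2} exp(-‖w‖²/2)` with respect to Lebesgue measure. -/
noncomputable def stdGaussian (d : ℕ) : Measure (EuclideanSpace ℝ (Fin d)) :=
  (volume : Measure (EuclideanSpace ℝ (Fin d))).withDensity
    (fun w => ENNReal.ofReal ((2 * π) ^ (-(d : ℝ) / 2) * Real.exp (-‖w‖ ^ 2 / 2)))

section GaussianKernel

variable {V : Type*} [NormedAddCommGroup V]

theorem norm_mul_exp_neg_sq_norm_sub_le (w : V) {u : V} (hu : ‖u‖ ≤ 1) :
    ‖w - u‖ * Real.exp (-‖w - u‖ ^ 2 / 2) ≤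
      4 * Real.exp (1 / 4) * Real.exp (-(1 / 8) * ‖w‖ ^ 2) := by
  have htri : ‖w‖ ≤ ‖w - u‖ + 1 := by
    calc ‖w‖ = ‖(w - u) + u‖ := by simp
      _ ≤ ‖w - u‖ + ‖u‖ := norm_add_le _ _
      _ ≤ ‖w - u‖ + 1 := by gcongr
  have hlin : ‖w - u‖ ≤ 4 * Real.exp (‖w - u‖ ^ 2 / 4) := by
    nlinarith [Real.add_one_le_exp (‖w - u‖ ^ 2 / 4), sq_nonneg (‖w - u‖ - 1)]
  calc ‖w - u‖ * Real.exp (-‖w - u‖ ^ 2 / 2)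
      ≤ 4 * Real.exp (‖w - u‖ ^ 2 / 4) * Real.exp (-‖w - u‖ ^ 2 / 2) := by gcongr
    _ = 4 * Real.exp (-‖w - u‖ ^ 2 / 4) := by
      rw [mul_assoc, ← Real.exp_add]
      ring_nf
    _ ≤ 4 * Real.exp (1 / 4 + -(1 / 8) * ‖w‖ ^ 2) := by
      gcongr
      nlinarith [sq_nonneg (‖w - u‖ - 1), norm_nonneg w, norm_nonneg (w - u)]
    _ = 4 * Real.exp (1 / 4) * Real.exp (-(1 / 8) * ‖w‖ ^ 2) := by
      rw [Real.exp_add, mul_assoc]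

variable [InnerProductSpace ℝ V]

theorem hasGradientAt_exp_neg_sq_norm_sub [CompleteSpace V] (w u : V) :
    HasGradientAt (fun u : V => Real.exp (-‖w - u‖ ^ 2 / 2))
      (Real.exp (-‖w - u‖ ^ 2 / 2) • (w - u)) u := by
  rw [hasGradientAt_iff_hasFDerivAt]
  have h := (((hasFDerivAt_id u).const_sub w).norm_sq.neg.mul_const (1 / 2 : ℝ)).exp
  convert! h using 1
  · ext v
    simp [div_eq_mul_inv]
  · ext v
    simp [div_eq_mul_inv]
    ring

variable [FiniteDimensional ℝ V] [MeasurableSpace V] [BorelSpace V]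

theorem integrable_exp_neg_mul_sq_norm {b : ℝ} (hb : 0 < b) :
    Integrable (fun w : V => Real.exp (-b * ‖w‖ ^ 2)) := by
  have h := (GaussianFourier.integrable_cexp_neg_mul_sq_norm_add (V := V) (b := (b : ℂ))
    (by simpa using hb) 0 0).norm
  refine h.congr (ae_of_all _ fun w => ?_)
  simp only [Complex.norm_exp]
  norm_cast
  simp

/-- Convolving a bounded measurable function with the Gaussian kernel can be differentiated under
the integral sign. -/
theorem hasGradientAt_integral_mul_exp_neg_sq_norm_sub {F : V → ℝ} (hF : Measurable F)
    {C : ℝ} (hC : ∀ w, |F w| ≤ C) :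
    HasGradientAt (fun u : V => ∫ w, F w * Real.exp (-‖w - u‖ ^ 2 / 2))
      (∫ w, (F w * Real.exp (-‖w‖ ^ 2 / 2)) • w) 0 := by
  have hC0 : 0 ≤ C := (abs_nonneg _).trans (hC 0)
  have hmeas (u : V) :
      AEStronglyMeasurable (fun w : V => F w * Real.exp (-‖w - u‖ ^ 2 / 2)) volume := by
    fun_prop
  have hgrad_meas : AEStronglyMeasurable
      (fun w : V => (F w * Real.exp (-‖w - 0‖ ^ 2 / 2)) • (w - 0)) volume := by
    fun_prop
  have hint : Integrable (fun w : V => F w * Real.exp (-‖w - 0‖ ^ 2 / 2)) := by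
    refine (integrable_exp_neg_mul_sq_norm (V := V) one_half_pos).bdd_mul
      hF.aestronglyMeasurable (c := C) (ae_of_all _ hC) |>.congr (ae_of_all _ fun w => ?_)
    simp only [sub_zero]
    ring_nf
  have hbound (w u : V) (hu : ‖u‖ ≤ 1) :
      ‖(F w * Real.exp (-‖w - u‖ ^ 2 / 2)) • (w - u)‖ ≤
        C * (4 * Real.exp (1 / 4) * Real.exp (-(1 / 8) * ‖w‖ ^ 2)) := by
    rw [norm_smul, norm_mul, Real.norm_eq_abs, Real.norm_eq_abs, Real.abs_exp, mul_assoc,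
      mul_comm (Real.exp _)]
    exact mul_le_mul (hC w) (norm_mul_exp_neg_sq_norm_sub_le w hu) (by positivity) hC0
  have hbound_int : Integrable
      (fun w : V => C * (4 * Real.exp (1 / 4) * Real.exp (-(1 / 8) * ‖w‖ ^ 2))) :=
    ((integrable_exp_neg_mul_sq_norm (by norm_num)).const_mul _).const_mul _
  let D := (InnerProductSpace.toDual ℝ V).toContinuousLinearEquiv.toContinuousLinearMap
  have hderiv := hasFDerivAt_integral_of_dominated_of_fderiv_le (𝕜 := ℝ) (x₀ := (0 : V))
    (F' := fun u w =>
      InnerProductSpace.toDual ℝ V ((F w * Real.exp (-‖w - u‖ ^ 2 / 2)) • (w - u)))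
    (Metric.ball_mem_nhds (0 : V) one_pos) (Filter.Eventually.of_forall hmeas) hint
    ((InnerProductSpace.toDual ℝ V).continuous.comp_aestronglyMeasurable hgrad_meas)
    (ae_of_all _ fun w u hu => by
      rw [LinearIsometryEquiv.norm_map]
      exact hbound w u (mem_ball_zero_iff.mp hu).le)
    hbound_int
    (ae_of_all _ fun w u _ => by
      have h := (hasGradientAt_exp_neg_sq_norm_sub w u).hasFDerivAt.const_mul (F w)
      rw [mul_smul, map_smulₛₗ]
      exact h)
  have hgrad_int : Integrable
      (fun w : V => (F w * Real.exp (-‖w - 0‖ ^ 2 / 2)) • (w - 0)) :=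
    hbound_int.mono' hgrad_meas (ae_of_all _ fun w => hbound w 0 (by simp))
  have hcomm : ∫ w, InnerProductSpace.toDual ℝ V
        ((F w * Real.exp (-‖w - 0‖ ^ 2 / 2)) • (w - 0)) =
      InnerProductSpace.toDual ℝ V (∫ w, (F w * Real.exp (-‖w - 0‖ ^ 2 / 2)) • (w - 0)) :=
    (innerSL ℝ (E := V)).integral_comp_comm hgrad_int
  rw [hasGradientAt_iff_hasFDerivAt]
  rw [hcomm] at hderiv
  simpa only [sub_zero] using hderiv

end GaussianKernel

theorem integral_stdGaussian {d : ℕ} {E : Type*} [NormedAddCommGroup E] [NormedSpace ℝ E]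
    (F : EuclideanSpace ℝ (Fin d) → E) :
    ∫ w, F w ∂(stdGaussian d) =
      ∫ w, ((2 * π) ^ (-(d : ℝ) / 2) * Real.exp (-‖w‖ ^ 2 / 2)) • F w := by
  rw [stdGaussian, integral_withDensity_eq_integral_toReal_smul (by fun_prop)
    (ae_of_all _ fun _ => ENNReal.ofReal_lt_top)]
  refine integral_congr_ae (ae_of_all _ fun w => ?_)
  simp only
  rw [ENNReal.toReal_ofReal (by positivity)]

/-- **Stein's (Gaussian smoothing) identity.** For `d ≥ 1`, `σ > 0` and a bounded measurable
`f : ℝ^d → ℝ`, the Gaussian-smoothed function `g(c) = ∫ f(c + σ·w) dγ(w)` is differentiable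
at every `c`, with gradient `∇g(c) = (1/σ) · ∫ f(c + σ·w) · w dγ(w)`. -/
theorem stein_gaussian_smoothing_identity
    (d : ℕ) (hd : 1 ≤ d) (σ : ℝ) (hσ : 0 < σ)
    (f : EuclideanSpace ℝ (Fin d) → ℝ)
    (hf_meas : Measurable f) (hf_bdd : ∃ C : ℝ, ∀ x, |f x| ≤ C)
    (g : EuclideanSpace ℝ (Fin d) → ℝ)
    (hg : g = fun c => ∫ w, f (c + σ • w) ∂(stdGaussian d)) :
    ∀ c : EuclideanSpace ℝ (Fin d),
      DifferentiableAt ℝ g c ∧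
      gradient g c = (1 / σ) • (∫ w, f (c + σ • w) • w ∂(stdGaussian d)) := by
  intro c
  obtain ⟨C, hC⟩ := hf_bdd
  set K : ℝ := (2 * π) ^ (-(d : ℝ) / 2)
  have hK0 : 0 ≤ K := by positivity
  have hsmooth (x : EuclideanSpace ℝ (Fin d)) : g x =
      ∫ w, (K * f (c + σ • w)) * Real.exp (-‖w - σ⁻¹ • (x - c)‖ ^ 2 / 2) := by
    rw [hg]
    simp only
    rw [integral_stdGaussian, ← integral_sub_right_eq_self _ (σ⁻¹ • (x - c))]
    refine integral_congr_ae (ae_of_all _ fun w => ?_)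
    have hshift : x + σ • (w - σ⁻¹ • (x - c)) = c + σ • w := by
      rw [smul_sub, smul_inv_smul₀ hσ.ne']
      abel
    simp only [hshift, smul_eq_mul]
    ring
  have hkernel := hasGradientAt_integral_mul_exp_neg_sq_norm_sub
    (F := fun w => K * f (c + σ • w)) (by fun_prop) (C := K * C) fun w => by
      rw [abs_mul, abs_of_nonneg hK0]
      exact mul_le_mul_of_nonneg_left (hC _) hK0
  have hmoment : ∫ w, f (c + σ • w) • w ∂(stdGaussian d) =
      ∫ w, ((K * f (c + σ • w)) * Real.exp (-‖w‖ ^ 2 / 2)) • w := by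
    rw [integral_stdGaussian]
    refine integral_congr_ae (ae_of_all _ fun w => ?_)
    simp only [smul_smul]
    congr 1
    ring
  have hgrad : HasGradientAt g ((1 / σ) • ∫ w, f (c + σ • w) • w ∂(stdGaussian d)) c := by
    rw [hmoment, funext hsmooth, hasGradientAt_iff_hasFDerivAt]
    have hinner : HasFDerivAt (fun x : EuclideanSpace ℝ (Fin d) => σ⁻¹ • (x - c))
        (σ⁻¹ • ContinuousLinearMap.id ℝ _) c :=
      ((hasFDerivAt_id c).sub_const c).const_smul σ⁻¹
    have hcomp := HasFDerivAt.comp c (by simpa using hkernel.hasFDerivAt) hinner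
    convert! hcomp using 1
    ext v
    simp
  exact ⟨hgrad.differentiableAt, hgrad.gradient⟩
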